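/- arXiv:math/0302232 — 4 statements merged into one kernel-verified Lean document; each statement's English description precedes it below -/
import Mathlib

section
/- Let M > 0. The set 𝒬_M(R) is closed in 𝒬(R) for the topology defined by the seminorms ν_{ω,n}; explicitly, if φ ∈ 𝒬(R) is such that for every bounded subset ω of 𝔞*(P,R) ∩ E, every n ∈ ℕ and every ε > 0 there exists ψ ∈ 𝒬_M(R) with ν_{ω,n}(φ − ψ) ≤ ε, then φ ∈ 𝒬_M(R). -/
noncomputable section

open Complex Real

/-- ℂ^d with the Euclidean norm. -/
abbrev Cd (d : ℕ) := EuclideanSpace ℂ (Fin d)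
/-- ℝ^d with the Euclidean norm. -/
abbrev Ed (d : ℕ) := EuclideanSpace ℝ (Fin d)

/-- Componentwise real part. -/
def rePart (d : ℕ) (l : Cd d) : Ed d := WithLp.toLp 2 (fun j => (l j).re)

/-- Inclusion of ℝ^d into ℂ^d. -/
def toC (d : ℕ) (x : Ed d) : Cd d := WithLp.toLp 2 (fun j => (x j : ℂ))

/-- The tube 𝔞*(P,R). -/
def aStar (d : ℕ) (Sp : Finset (Ed d)) (R : ℝ) : Set (Cd d) :=
  {l | ∀ α ∈ Sp, (∑ j, (l j).re * α j) < R}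

/-- The seminorm ν_{ω,n}. -/
def nu (d : ℕ) (ω : Set (Ed d)) (n : ℕ) (φ : Cd d → ℂ) : ℝ :=
  sSup {r : ℝ | ∃ l : Cd d, rePart d l ∈ ω ∧ r = (1 + ‖l‖) ^ n * ‖φ l‖}

/-- Membership in 𝒬(R). -/
def memQ (d : ℕ) (Sp : Finset (Ed d)) (R : ℝ) (φ : Cd d → ℂ) : Prop :=
  DifferentiableOn ℂ φ (aStar d Sp R) ∧
  ∀ (n : ℕ) (ω : Set (Ed d)), Bornology.IsBounded ω → toC d '' ω ⊆ aStar d Sp R →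
    ∃ C : ℝ, ∀ l : Cd d, rePart d l ∈ ω → (1 + ‖l‖) ^ n * ‖φ l‖ ≤ C

/-- Strictly antidominant. -/
def Antidom (d : ℕ) (Sp : Finset (Ed d)) (η : Ed d) : Prop :=
  ∀ α ∈ Sp, (∑ j, η j * α j) < 0

/-- Membership in 𝒬_M(R). -/
def memQM (d : ℕ) (Sp : Finset (Ed d)) (R M : ℝ) (φ : Cd d → ℂ) : Prop :=
  memQ d Sp R φ ∧
  ∀ η : Ed d, Antidom d Sp η →
    ∃ tη Cη : ℝ, 0 < tη ∧ 0 < Cη ∧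
      ∀ t : ℝ, tη ≤ t → ∀ l : Cd d, rePart d l = t • η →
        ‖φ l‖ ≤
          Cη * (1 + ‖l‖) ^ (-(d : ℝ) - 1) * Real.exp (M * ‖rePart d l‖)

lemma aux_nu (d : ℕ) (Sp : Finset (Ed d)) (R : ℝ) (φ ψ : Cd d → ℂ) (hφ : memQ d Sp R φ)
    (hψ : memQ d Sp R ψ) (ω : Set (Ed d)) (hb : Bornology.IsBounded ω)
    (hω : toC d '' ω ⊆ aStar d Sp R) (n : ℕ) (ε : ℝ)
    (h : nu d ω n (fun l => φ l - ψ l) ≤ ε) (l : Cd d) (hl : rePart d l ∈ ω) :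
    (1 + ‖l‖) ^ n * ‖φ l - ψ l‖ ≤ ε := by
  obtain ⟨C1, h1⟩ := hφ.2 n ω hb hω
  obtain ⟨C2, h2⟩ := hψ.2 n ω hb hω
  unfold nu at h
  refine le_trans (le_csSup (s := {r : ℝ | ∃ l : Cd d, rePart d l ∈ ω ∧ r = (1 + ‖l‖) ^ n * ‖φ l - ψ l‖}) ?_ ⟨l, hl, rfl⟩) h
  refine ⟨C1 + C2, ?_⟩
  rintro r ⟨m, hm, rfl⟩
  calc (1 + ‖m‖) ^ n * ‖φ m - ψ m‖ ≤ (1 + ‖m‖) ^ n * (‖φ m‖ + ‖ψ m‖) := by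
        gcongr; exact norm_sub_le _ _
    _ = (1 + ‖m‖) ^ n * ‖φ m‖ + (1 + ‖m‖) ^ n * ‖ψ m‖ := by ring
    _ ≤ _ := add_le_add (h1 m hm) (h2 m hm)

lemma aux_t0 (d : ℕ) (Sp : Finset (Ed d)) (R : ℝ) (η : Ed d) (hη : Antidom d Sp η) :
    ∃ t0 : ℝ, 0 < t0 ∧ ∀ t, t0 ≤ t → ∀ α ∈ Sp, (∑ j, (t * η j) * α j) < R := by
  have h : ∀ᶠ t : ℝ in Filter.atTop, ∀ α ∈ Sp, (∑ j, (t * η j) * α j) < R := by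
    rw [Filter.eventually_all_finset]
    intro α hα
    have h1 : Filter.Tendsto (fun t : ℝ => t * ∑ j, η j * α j) Filter.atTop Filter.atBot :=
      Filter.tendsto_id.atTop_mul_const_of_neg (hη α hα)
    filter_upwards [h1.eventually_lt_atBot R] with t ht
    simpa [Finset.mul_sum, mul_assoc] using ht
  obtain ⟨a, ha⟩ := Filter.eventually_atTop.1 h
  exact ⟨max a 1, by positivity, fun t ht => ha t (le_trans (le_max_left _ _) ht)⟩

lemma aux_rpow (d : ℕ) (x : ℝ) (hx : 0 ≤ x) :
    (1 + x) ^ (-(d : ℝ) - 1) = ((1 + x) ^ (d + 1))⁻¹ := by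
  have : -(d : ℝ) - 1 = -((d + 1 : ℕ) : ℝ) := by push_cast; ring
  rw [this, Real.rpow_neg (by positivity), Real.rpow_natCast]

lemma aux_tube (d : ℕ) (Sp : Finset (Ed d)) (R : ℝ) (η : Ed d) (t : ℝ)
    (h : ∀ α ∈ Sp, (∑ j, (t * η j) * α j) < R) (l : Cd d) (hl : rePart d l = t • η) :
    l ∈ aStar d Sp R := by
  intro α hα
  have : ∀ j, (l j).re = t * η j := fun j => by
    have := congrArg (fun v : Ed d => v j) hl
    simpa [rePart] using this
  simpa [this] using h α hα

lemma rePart_toC (d : ℕ) (x : Ed d) : rePart d (toC d x) = x := by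
  ext j; simp [rePart, toC]

lemma aux_PL (d : ℕ) (Sp : Finset (Ed d)) (R M : ℝ) (ψ : Cd d → ℂ)
    (hψ : memQM d Sp R M ψ) (η : Ed d) (hη : Antidom d Sp η) (t0 : ℝ) (h0 : 0 < t0)
    (ht0 : ∀ t, t0 ≤ t → ∀ α ∈ Sp, (∑ j, (t * η j) * α j) < R)
    (N : ℝ) (hN : ∀ l : Cd d, rePart d l = t0 • η → (1 + ‖l‖) ^ (d + 1) * ‖ψ l‖ ≤ N)
    (hM : 0 < M)
    (t : ℝ) (ht : t0 ≤ t) (l0 : Cd d) (hl0 : rePart d l0 = t • η) :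
    (1 + ‖l0‖) ^ (d + 1) * ‖ψ l0‖ ≤ N * Real.exp (M * ‖η‖ * (t - t0)) := by
  obtain ⟨t1, C, ht1, hC, hfar⟩ := hψ.2 η hη
  set L : ℂ → Cd d := fun z => l0 + (z - ((t - t0 : ℝ) : ℂ)) • toC d η with hL
  have hLre : ∀ z, rePart d (L z) = (t0 + z.re) • η := by
    intro z
    ext j
    have := congrArg (fun v : Ed d => v j) hl0
    simp [rePart] at this
    simp [hL, rePart, toC, this]
    ring
  have hLmem : ∀ z : ℂ, 0 ≤ z.re → L z ∈ aStar d Sp R := fun z hz =>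
    aux_tube d Sp R η (t0 + z.re) (ht0 _ (by linarith)) _ (hLre z)
  set w : Cd d → ℂ := fun l => 1 + ((‖l0‖ : ℂ))⁻¹ * inner ℂ l0 l with hw
  have hwle : ∀ l, ‖w l‖ ≤ 1 + ‖l‖ := by
    intro l
    refine (norm_add_le _ _).trans ?_
    rw [norm_one, norm_mul, norm_inv, Complex.norm_real, norm_norm]
    gcongr
    by_cases h : ‖l0‖ = 0
    · simp [h]
    · rw [inv_mul_le_iff₀ (lt_of_le_of_ne (norm_nonneg _) (Ne.symm h))]
      exact norm_inner_le_norm _ _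
  have hw0 : ‖w l0‖ = 1 + ‖l0‖ := by
    have : w l0 = ((1 + ‖l0‖ : ℝ) : ℂ) := by
      simp only [hw, inner_self_eq_norm_sq_to_K]
      by_cases h : ‖l0‖ = 0
      · simp [h]
      · have : (‖l0‖ : ℂ) ≠ 0 := by exact_mod_cast h
        push_cast
        simp only [Complex.coe_algebraMap]
        field_simp
    rw [this, Complex.norm_real, Real.norm_of_nonneg (by positivity)]
  set f : ℂ → ℂ := fun z => Complex.exp (-((M * ‖η‖ : ℝ) : ℂ) * z) * (w (L z)) ^ (d + 1) * ψ (L z)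
    with hf
  have hfn : ∀ z, ‖f z‖ = Real.exp (-(M * ‖η‖) * z.re) * ‖w (L z)‖ ^ (d + 1) * ‖ψ (L z)‖ := by
    intro z
    simp only [hf, norm_mul, norm_pow, Complex.norm_exp]
    congr 3
    simp
  have hfle : ∀ z, ‖f z‖ ≤ Real.exp (-(M * ‖η‖) * z.re) * ((1 + ‖L z‖) ^ (d + 1) * ‖ψ (L z)‖) := by
    intro z
    rw [hfn, mul_assoc]
    gcongr
    exact hwle _
  -- global bound
  have hbd : ∃ B : ℝ, ∀ z : ℂ, 0 ≤ z.re → ‖f z‖ ≤ B := by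
    set ω : Set (Ed d) := (fun s : ℝ => s • η) '' Set.Icc t0 (max t0 t1) with hω
    have hωb : Bornology.IsBounded ω :=
      (isCompact_Icc.image (by fun_prop)).isBounded
    have hωs : toC d '' ω ⊆ aStar d Sp R := by
      rintro _ ⟨_, ⟨s, hs, rfl⟩, rfl⟩
      exact aux_tube d Sp R η s (ht0 s hs.1) _ (rePart_toC d _)
    obtain ⟨B, hB⟩ := hψ.1.2 (d + 1) ω hωb hωs
    refine ⟨max B (C * Real.exp (M * ‖η‖ * t0)), fun z hz => (hfle z).trans ?_⟩
    by_cases hs : t0 + z.re ≤ max t0 t1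
    · refine le_trans ?_ (le_max_left _ _)
      have h1 := hB (L z) (by rw [hLre]; exact ⟨_, ⟨by linarith, hs⟩, rfl⟩)
      refine le_trans (mul_le_of_le_one_left (by positivity) ?_) h1
      rw [Real.exp_le_one_iff]
      have : 0 ≤ M * ‖η‖ * z.re := by positivity
      linarith
    · refine le_trans ?_ (le_max_right _ _)
      have h2 := hfar (t0 + z.re) ((le_max_right _ _).trans (not_le.1 hs).le) (L z) (hLre z)
      rw [aux_rpow d _ (norm_nonneg _), hLre, norm_smul, Real.norm_of_nonneg (by linarith)] at h2
      have hp : 0 < (1 + ‖L z‖) ^ (d + 1) := by positivity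
      calc _ ≤ Real.exp (-(M * ‖η‖) * z.re) * ((1 + ‖L z‖) ^ (d + 1) *
            (C * ((1 + ‖L z‖) ^ (d + 1))⁻¹ * Real.exp (M * ((t0 + z.re) * ‖η‖)))) := by gcongr
        _ = C * (Real.exp (-(M * ‖η‖) * z.re) * Real.exp (M * ((t0 + z.re) * ‖η‖))) := by
            field_simp
        _ = C * Real.exp (M * ‖η‖ * t0) := by
            rw [← Real.exp_add]; congr 2; ring
        _ ≤ _ := le_rfl
  obtain ⟨B, hB⟩ := hbd
  have hLd : Differentiable ℂ L := by
    intro z; simp only [hL]; fun_prop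
  have hwd : Differentiable ℂ w := by
    have : w = fun l => 1 + ((‖l0‖ : ℂ))⁻¹ * innerSL ℂ l0 l := by
      ext l; simp [hw]
    rw [this]; fun_prop
  have hfd : DiffContOnCl ℂ f {z | 0 < z.re} := by
    apply DifferentiableOn.diffContOnCl
    rw [Complex.closure_setOfPred_lt_re]
    have h1 : DifferentiableOn ℂ (fun z => ψ (L z)) {z | 0 ≤ z.re} :=
      hψ.1.1.comp hLd.differentiableOn (fun z hz => hLmem z hz)
    have h2 : Differentiable ℂ (fun z => (w (L z)) ^ (d + 1)) := (hwd.comp hLd).pow _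
    have h3 : Differentiable ℂ (fun z => Complex.exp (-((M * ‖η‖ : ℝ) : ℂ) * z)) := by fun_prop
    exact (h3.mul h2).differentiableOn.mul h1
  have key : ‖f ((t - t0 : ℝ) : ℂ)‖ ≤ N := by
    apply PhragmenLindelof.right_half_plane_of_bounded_on_real hfd
    · refine ⟨1, by norm_num, 0, ?_⟩
      refine Asymptotics.IsBigO.of_bound B ?_
      rw [Filter.eventually_inf_principal]
      refine Filter.Eventually.of_forall fun z hz => ?_
      simpa using hB z (le_of_lt hz)
    · refine ⟨B, ?_⟩
      rw [Filter.eventually_map]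
      filter_upwards [Filter.eventually_ge_atTop 0] with x hx
      exact hB x (by simpa using hx)
    · intro x
      refine (hfle _).trans ?_
      simpa using hN (L (x * I)) (by rw [hLre]; simp)
    · simpa using ht
  rw [hfn] at key
  have hLt : L ((t - t0 : ℝ) : ℂ) = l0 := by simp [hL]
  rw [hLt, hw0, Complex.ofReal_re, mul_assoc, neg_mul, Real.exp_neg] at key
  rwa [inv_mul_le_iff₀ (Real.exp_pos _), mul_comm _ N] at key

/-- 𝒬_M(R) is closed in 𝒬(R). -/
theorem QM_closed_in_Q
    (d : ℕ) (hd : 1 ≤ d) (Sp : Finset (Ed d)) (hSp : (0 : Ed d) ∉ Sp)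
    (R M : ℝ) (hM : 0 < M)
    (φ : Cd d → ℂ) (hφ : memQ d Sp R φ)
    (happrox : ∀ ω : Set (Ed d), Bornology.IsBounded ω → toC d '' ω ⊆ aStar d Sp R →
      ∀ n : ℕ, ∀ ε : ℝ, 0 < ε →
        ∃ ψ : Cd d → ℂ, memQM d Sp R M ψ ∧ nu d ω n (fun l => φ l - ψ l) ≤ ε) :
    memQM d Sp R M φ := by
  refine ⟨hφ, fun η hη => ?_⟩
  obtain ⟨t0, h0, ht0⟩ := aux_t0 d Sp R η hη
  obtain ⟨N, hN⟩ := hφ.2 (d + 1) {t0 • η} Bornology.isBounded_singleton (by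
    rintro _ ⟨_, rfl, rfl⟩
    exact aux_tube d Sp R η t0 (ht0 t0 le_rfl) _ (rePart_toC d _))
  have hN0 : 0 ≤ N := le_trans (by positivity) (hN (toC d (t0 • η)) (rePart_toC d _))
  refine ⟨t0, N + 2, h0, by linarith, fun t ht l hl => ?_⟩
  have hωb : Bornology.IsBounded ({t0 • η, t • η} : Set (Ed d)) := (Set.toFinite _).isBounded
  have hωs : toC d '' ({t0 • η, t • η} : Set (Ed d)) ⊆ aStar d Sp R := by
    rintro _ ⟨x, hx, rfl⟩
    rcases hx with rfl | rfl
    · exact aux_tube d Sp R η t0 (ht0 t0 le_rfl) _ (rePart_toC d _)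
    · exact aux_tube d Sp R η t (ht0 t ht) _ (rePart_toC d _)
  obtain ⟨ψ, hψ, hnu⟩ := happrox _ hωb hωs (d + 1) 1 one_pos
  have hdiff := aux_nu d Sp R φ ψ hφ hψ.1 _ hωb hωs _ _ hnu
  have h1 := aux_PL d Sp R M ψ hψ η hη t0 h0 ht0 (N + 1) (fun m hm => by
    have a := hdiff m (by rw [hm]; simp)
    have b := hN m hm
    calc (1 + ‖m‖) ^ (d + 1) * ‖ψ m‖
        ≤ (1 + ‖m‖) ^ (d + 1) * (‖φ m‖ + ‖φ m - ψ m‖) := by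
          gcongr; simpa using norm_sub_le (φ m) (φ m - ψ m)
      _ ≤ N + 1 := by rw [mul_add]; exact add_le_add b a) hM t ht l hl
  have h2 := hdiff l (by rw [hl]; simp)
  have h3 : (1 + ‖l‖) ^ (d + 1) * ‖φ l‖ ≤ (N + 2) * Real.exp (M * ‖rePart d l‖) := by
    rw [hl, norm_smul, Real.norm_of_nonneg (by linarith)]
    have e1 : Real.exp (M * ‖η‖ * (t - t0)) ≤ Real.exp (M * (t * ‖η‖)) := by
      apply Real.exp_le_exp.2
      have : 0 ≤ M * ‖η‖ * t0 := by positivity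
      nlinarith
    have e2 : 1 ≤ Real.exp (M * (t * ‖η‖)) :=
      Real.one_le_exp (by have : 0 ≤ t := by linarith
                          positivity)
    calc (1 + ‖l‖) ^ (d + 1) * ‖φ l‖
        ≤ (1 + ‖l‖) ^ (d + 1) * (‖φ l - ψ l‖ + ‖ψ l‖) := by
          gcongr; simpa using norm_add_le (φ l - ψ l) (ψ l)
      _ ≤ 1 + (N + 1) * Real.exp (M * ‖η‖ * (t - t0)) := by
          rw [mul_add]; exact add_le_add h2 h1
      _ ≤ Real.exp (M * (t * ‖η‖)) + (N + 1) * Real.exp (M * (t * ‖η‖)) := by gcongr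
      _ = _ := by ring
  rw [aux_rpow d _ (norm_nonneg _)]
  have hp : 0 < (1 + ‖l‖) ^ (d + 1) := by positivity
  rw [mul_right_comm, ← div_eq_mul_inv, le_div_iff₀ hp, mul_comm]
  exact h3
end
end

section
/- Let M > 0 and let φ ∈ 𝒬_M(R). Then for every polynomial p : ℂ^d → ℂ the product p·φ again belongs to 𝒬_M(R). -/
noncomputable section

open Complex Real

theorem poly_bound (d : ℕ) (p : MvPolynomial (Fin d) ℂ) :
    ∃ (A : ℝ) (N : ℕ), 0 ≤ A ∧ ∀ l : Cd d,
      ‖MvPolynomial.eval (fun j => l j) p‖ ≤ A * (1 + ‖l‖) ^ N := by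
  induction p using MvPolynomial.induction_on with
  | C a => exact ⟨‖a‖, 0, norm_nonneg _, fun l => by simp⟩
  | add p q hp hq =>
    obtain ⟨A, N, hA, h1⟩ := hp
    obtain ⟨B, K, hB, h2⟩ := hq
    refine ⟨A + B, N + K, by positivity, fun l => ?_⟩
    have h : (1:ℝ) ≤ 1 + ‖l‖ := by linarith [norm_nonneg l]
    have e1 : (1 + ‖l‖) ^ N ≤ (1 + ‖l‖) ^ (N + K) := pow_le_pow_right₀ h (by omega)
    have e2 : (1 + ‖l‖) ^ K ≤ (1 + ‖l‖) ^ (N + K) := pow_le_pow_right₀ h (by omega)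
    rw [map_add]
    refine (norm_add_le _ _).trans ?_
    rw [add_mul]
    exact add_le_add ((h1 l).trans (by gcongr)) ((h2 l).trans (by gcongr))
  | mul_X p i hp =>
    obtain ⟨A, N, hA, h1⟩ := hp
    refine ⟨A, N + 1, hA, fun l => ?_⟩
    have h : ‖l i‖ ≤ 1 + ‖l‖ := by linarith [PiLp.norm_apply_le l i]
    rw [map_mul, MvPolynomial.eval_X, norm_mul, pow_succ, ← mul_assoc]
    have := norm_nonneg l
    exact mul_le_mul (h1 l) h (norm_nonneg _) (by positivity)

theorem poly_diff (d : ℕ) (p : MvPolynomial (Fin d) ℂ) :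
    Differentiable ℂ (fun l : Cd d => MvPolynomial.eval (fun j => l j) p) := by
  induction p using MvPolynomial.induction_on with
  | C a => simp
  | add p q hp hq =>
    simp only [map_add]
    exact hp.add hq
  | mul_X p i hp =>
    simp only [map_mul, MvPolynomial.eval_X]
    exact hp.mul (by fun_prop)

theorem memQ_mul (d : ℕ) (Sp : Finset (Ed d)) (R : ℝ) (φ : Cd d → ℂ) (hφ : memQ d Sp R φ)
    (p : MvPolynomial (Fin d) ℂ) :
    memQ d Sp R (fun l => MvPolynomial.eval (fun j => l j) p * φ l) := by
  refine ⟨(poly_diff d p).differentiableOn.mul hφ.1, fun n ω hω hs => ?_⟩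
  obtain ⟨A, N, hA, h⟩ := poly_bound d p
  obtain ⟨C, hC⟩ := hφ.2 (n + N) ω hω hs
  refine ⟨A * C, fun l hl => ?_⟩
  have := norm_nonneg l
  calc (1 + ‖l‖) ^ n * ‖MvPolynomial.eval (fun j => l j) p * φ l‖
      = ‖MvPolynomial.eval (fun j => l j) p‖ * ((1 + ‖l‖) ^ n * ‖φ l‖) := by rw [norm_mul]; ring
    _ ≤ (A * (1 + ‖l‖) ^ N) * ((1 + ‖l‖) ^ n * ‖φ l‖) := by gcongr; exact h l
    _ = A * ((1 + ‖l‖) ^ (n + N) * ‖φ l‖) := by ring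
    _ ≤ A * C := by gcongr; exact hC l hl

theorem key (d : ℕ) (Sp : Finset (Ed d)) (R M : ℝ)
    (φ : Cd d → ℂ) (hφ : memQM d Sp R M φ) (η : Ed d) (hη : Antidom d Sp η) :
    ∃ t0 : ℝ, 0 < t0 ∧ ∀ q : MvPolynomial (Fin d) ℂ, ∃ C : ℝ, 0 ≤ C ∧
      ∀ t : ℝ, t0 ≤ t → ∀ l : Cd d, rePart d l = t • η →
        ‖MvPolynomial.eval (fun j => l j) q * φ l‖ ≤ C * Real.exp (M * ‖rePart d l‖) := by
  obtain ⟨⟨hd, hb⟩, h2⟩ := hφ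
  obtain ⟨tη, Cη, ht, hC, hbound⟩ := h2 η hη
  have hev : ∀ᶠ t : ℝ in Filter.atTop, ∀ α ∈ Sp, t * (∑ j, η j * α j) < R := by
    rw [Filter.eventually_all_finset]
    intro α hα
    exact (Filter.tendsto_id.atTop_mul_const_of_neg (hη α hα)).eventually_lt_atBot R
  obtain ⟨T, hT⟩ := Filter.eventually_atTop.1 hev
  have hmem : ∀ t, T ≤ t → ∀ l : Cd d, rePart d l = t • η → l ∈ aStar d Sp R := by
    intro t ht l hl α hα
    have := hT t ht α hα
    rw [Finset.mul_sum] at this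
    convert this using 2 with j
    have hj : (l j).re = t * η j := by
      have := congrArg (fun v : Ed d => v j) hl
      simpa [rePart] using this
    rw [hj]; ring
  have hbd : ∀ t, tη ≤ t → ∀ l : Cd d, rePart d l = t • η →
      ‖φ l‖ ≤ Cη * Real.exp (M * ‖η‖ * t) := by
    intro t h l hl
    refine (hbound t h l hl).trans ?_
    have ht0 : 0 < t := ht.trans_le h
    have e : ‖rePart d l‖ = t * ‖η‖ := by rw [hl, norm_smul, Real.norm_of_nonneg ht0.le]
    rw [e]
    have h1 : (1 + ‖l‖) ^ (-(d : ℝ) - 1) ≤ 1 :=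
      Real.rpow_le_one_of_one_le_of_nonpos (by linarith [norm_nonneg l])
        (by have := Nat.cast_nonneg (α := ℝ) d; linarith)
    rw [show M * (t * ‖η‖) = M * ‖η‖ * t by ring]
    gcongr
    exact mul_le_of_le_one_right hC.le h1
  set t0 := max tη T with ht0
  have ht0p : 0 < t0 := ht.trans_le (le_max_left _ _)
  refine ⟨t0, ht0p, fun q => ?_⟩
  obtain ⟨A, N, hA, hq⟩ := poly_bound d q
  obtain ⟨B, hB⟩ := hb N {t0 • η} Bornology.isBounded_singleton (by
    rintro _ ⟨x, hx, rfl⟩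
    rw [Set.mem_singleton_iff] at hx
    refine hmem t0 (le_max_right _ _) _ ?_
    rw [← hx]; ext j; simp [rePart, toC])
  set K := M * ‖η‖ with hK
  set B' := A * |B| * Real.exp (-K * t0) with hB'
  have hB0 : 0 ≤ B' := by positivity
  refine ⟨B', hB0, fun t h l hl => ?_⟩
  set μ : Ed d := WithLp.toLp 2 (fun j => (l j).im) with hμ
  set L : ℂ → Cd d := fun z => (z + t0) • toC d η + I • toC d μ with hL
  have hre : ∀ z, rePart d (L z) = (z.re + t0) • η := by
    intro z; ext j; simp [rePart, L, toC]
  have hlL : L ((t - t0 : ℝ) : ℂ) = l := by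
    ext j
    have hj : (l j).re = t * η j := by
      have := congrArg (fun v : Ed d => v j) hl
      simpa [rePart] using this
    simp only [L, toC, hμ]
    apply Complex.ext <;> simp [hj]
  have hLd : Differentiable ℂ L := by
    intro z
    exact (((differentiableAt_id.add_const _).smul_const _).add_const _)
  obtain ⟨D, hD0, hD⟩ : ∃ D : ℝ, 0 ≤ D ∧ ∀ z, 1 + ‖L z‖ ≤ D * (1 + ‖z‖) := by
    refine ⟨1 + ‖toC d η‖ + t0 * ‖toC d η‖ + ‖I • toC d μ‖, by positivity, fun z => ?_⟩
    have h1 : ‖L z‖ ≤ (‖z‖ + t0) * ‖toC d η‖ + ‖I • toC d μ‖ := by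
      refine (norm_add_le _ _).trans ?_
      rw [norm_smul (z + t0)]
      gcongr
      refine (norm_add_le _ _).trans ?_
      simp [abs_of_pos ht0p]
    have := norm_nonneg z
    have h3 : 0 ≤ (1 + t0 * ‖toC d η‖ + ‖I • toC d μ‖) * ‖z‖ := by positivity
    have h4 : 0 ≤ ‖toC d η‖ := norm_nonneg _
    nlinarith
  have main : ∀ ε : ℝ, 0 < ε →
      ‖MvPolynomial.eval (fun j => l j) q * φ l‖ ≤ B' * Real.exp ((K + ε) * t) := by
    intro ε hε
    set g : ℂ → ℂ := fun z => (MvPolynomial.eval (fun j => L z j) q * φ (L z)) *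
      Complex.exp (-((K + ε : ℝ) : ℂ) * (z + t0)) with hg
    have hexpn : ∀ z : ℂ, ‖Complex.exp (-((K + ε : ℝ) : ℂ) * (z + t0))‖
        = Real.exp (-(K + ε) * (z.re + t0)) := by
      intro z
      rw [Complex.norm_exp]; simp
    have hgb : ∀ z : ℂ, 0 ≤ z.re →
        ‖g z‖ ≤ A * Cη * D ^ N * ((1 + ‖z‖) ^ N * Real.exp (-ε * z.re)) := by
      intro z hz
      have h1 := hbd (z.re + t0) (by linarith [le_max_left tη T]) (L z) (hre z)
      have h2 : ‖MvPolynomial.eval (fun j => L z j) q‖ ≤ A * (D * (1 + ‖z‖)) ^ N :=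
        (hq _).trans (by gcongr; exact hD z)
      simp only [hg]
      rw [norm_mul, norm_mul, hexpn]
      have h3 : Real.exp (K * (z.re + t0)) * Real.exp (-(K + ε) * (z.re + t0))
          ≤ Real.exp (-ε * z.re) := by
        rw [← Real.exp_add]
        apply Real.exp_le_exp.2
        nlinarith
      calc _ ≤ (A * (D * (1 + ‖z‖)) ^ N) * (Cη * Real.exp (K * (z.re + t0)))
              * Real.exp (-(K + ε) * (z.re + t0)) := by
            gcongr
        _ = A * Cη * D ^ N * ((1 + ‖z‖) ^ N * (Real.exp (K * (z.re + t0)) * Real.exp (-(K + ε) * (z.re + t0)))) := by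
            rw [mul_pow]; ring
        _ ≤ _ := by gcongr
    have hPL : ‖g ((t - t0 : ℝ) : ℂ)‖ ≤ B' := by
      refine PhragmenLindelof.right_half_plane_of_bounded_on_real (C := B') ?_ ?_ ?_ ?_ ?_
      · apply DifferentiableOn.diffContOnCl
        rw [Complex.closure_setOfPred_lt_re]
        have hφL : DifferentiableOn ℂ (fun z => φ (L z)) {z : ℂ | 0 ≤ z.re} := by
          refine hd.comp hLd.differentiableOn ?_
          intro z hz
          have hz' : 0 ≤ z.re := hz
          exact hmem _ (by linarith [le_max_right tη T]) _ (hre z)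
        refine (DifferentiableOn.mul ?_ hφL).mul ?_
        · exact ((poly_diff d q).comp hLd).differentiableOn
        · exact Differentiable.differentiableOn (by fun_prop)
      · refine ⟨1, by norm_num, N, ?_⟩
        refine Asymptotics.IsBigO.of_bound (A * Cη * D ^ N) ?_
        refine Filter.Eventually.filter_mono inf_le_right ?_
        rw [Filter.eventually_principal]
        intro z hz
        have hz' : 0 < z.re := hz
        refine (hgb z hz'.le).trans ?_
        rw [Real.norm_of_nonneg (Real.exp_pos _).le, Real.rpow_one]
        have h1 : Real.exp (-ε * z.re) ≤ 1 := Real.exp_le_one_iff.2 (by nlinarith)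
        have h2 : (1 + ‖z‖) ^ N ≤ Real.exp (N * ‖z‖) := by
          rw [Real.exp_nat_mul]
          gcongr
          linarith [Real.add_one_le_exp ‖z‖]
        gcongr
        calc _ ≤ (1 + ‖z‖) ^ N * 1 := by gcongr
          _ ≤ _ := by simpa using h2
      · refine Filter.isBoundedUnder_of_eventually_le
          (a := A * Cη * D ^ N * (N.factorial * Real.exp ε / ε ^ N)) ?_
        filter_upwards [Filter.eventually_ge_atTop 0] with x hx
        refine (hgb x (by simpa using hx)).trans ?_
        gcongr
        have h1 := Real.pow_div_factorial_le_exp (ε * (1 + x)) (by positivity) N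
        rw [div_le_iff₀ (by positivity), mul_pow, show ε * (1 + x) = ε + ε * x by ring,
          Real.exp_add] at h1
        rw [Complex.norm_real, Real.norm_of_nonneg hx, Complex.ofReal_re,
          le_div_iff₀ (by positivity)]
        have h2 : Real.exp (-ε * x) * Real.exp (ε * x) = 1 := by
          rw [← Real.exp_add]; simp
        calc (1 + x) ^ N * Real.exp (-ε * x) * ε ^ N
            = (ε ^ N * (1 + x) ^ N) * Real.exp (-ε * x) := by ring
          _ ≤ (Real.exp ε * Real.exp (ε * x) * N.factorial) * Real.exp (-ε * x) := by gcongr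
          _ = N.factorial * Real.exp ε * (Real.exp (-ε * x) * Real.exp (ε * x)) := by ring
          _ = _ := by rw [h2, mul_one]
      · intro x
        have hr : (x * I : ℂ).re = 0 := by simp
        have hr2 := hre (x * I)
        rw [hr, zero_add] at hr2
        have h1 := hB (L (x * I)) hr2
        simp only [hg]
        rw [norm_mul, norm_mul, hexpn, hr, hB']
        have h2 : Real.exp (-(K + ε) * (0 + t0)) ≤ Real.exp (-K * t0) := by
          apply Real.exp_le_exp.2; nlinarith
        refine mul_le_mul ?_ h2 (Real.exp_pos _).le (by positivity)
        calc _ ≤ (A * (1 + ‖L (x * I)‖) ^ N) * ‖φ (L (x * I))‖ := by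
              gcongr; exact hq _
          _ = A * ((1 + ‖L (x * I)‖) ^ N * ‖φ (L (x * I))‖) := by ring
          _ ≤ A * |B| := by gcongr; exact h1.trans (le_abs_self B)
      · simpa using h
    simp only [hg] at hPL
    rw [norm_mul, hexpn, hlL] at hPL
    rw [Complex.ofReal_re, sub_add_cancel, neg_mul, Real.exp_neg, ← div_eq_mul_inv,
      div_le_iff₀ (Real.exp_pos _)] at hPL
    exact hPL
  have e : M * ‖rePart d l‖ = (K + 0) * t := by
    rw [hl, norm_smul, Real.norm_of_nonneg (ht0p.le.trans h), hK]; ring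
  rw [e]
  have hcont : Filter.Tendsto (fun ε : ℝ => B' * Real.exp ((K + ε) * t)) (nhdsWithin 0 (Set.Ioi 0))
      (nhds (B' * Real.exp ((K + 0) * t))) := by
    apply Filter.Tendsto.mono_left _ nhdsWithin_le_nhds
    exact Continuous.tendsto (by fun_prop) 0
  refine ge_of_tendsto hcont ?_
  filter_upwards [self_mem_nhdsWithin] with ε hε
  exact main ε hε

theorem key2 (d : ℕ) (M t0 : ℝ) (φ : Cd d → ℂ) (η : Ed d)
    (H : ∀ q : MvPolynomial (Fin d) ℂ, ∃ C : ℝ, 0 ≤ C ∧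
      ∀ t : ℝ, t0 ≤ t → ∀ l : Cd d, rePart d l = t • η →
        ‖MvPolynomial.eval (fun j => l j) q * φ l‖ ≤ C * Real.exp (M * ‖rePart d l‖)) (n : ℕ) :
    ∀ q : MvPolynomial (Fin d) ℂ, ∃ C : ℝ, 0 ≤ C ∧
      ∀ t : ℝ, t0 ≤ t → ∀ l : Cd d, rePart d l = t • η →
        (1 + ‖l‖) ^ n * ‖MvPolynomial.eval (fun j => l j) q * φ l‖
          ≤ C * Real.exp (M * ‖rePart d l‖) := by
  induction n with
  | zero => simpa using H
  | succ n ih =>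
    intro q
    obtain ⟨C, hC, h⟩ := ih q
    choose C' hC' h' using fun j => ih (MvPolynomial.X j * q)
    refine ⟨C + ∑ j, C' j, add_nonneg hC (Finset.sum_nonneg fun j _ => hC' j),
      fun t ht l hl => ?_⟩
    have hn : ‖l‖ ≤ ∑ j, ‖l j‖ := by
      rw [EuclideanSpace.norm_eq]
      rw [Real.sqrt_le_left (Finset.sum_nonneg fun j _ => norm_nonneg _)]
      exact Finset.sum_sq_le_sq_sum_of_nonneg fun j _ => norm_nonneg _
    have := norm_nonneg l
    set Q := ‖MvPolynomial.eval (fun j => l j) q * φ l‖ with hQ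
    calc (1 + ‖l‖) ^ (n + 1) * Q = (1 + ‖l‖) ^ n * Q * (1 + ‖l‖) := by ring
      _ ≤ (1 + ‖l‖) ^ n * Q * (1 + ∑ j, ‖l j‖) := by gcongr
      _ = (1 + ‖l‖) ^ n * Q + ∑ j, (1 + ‖l‖) ^ n *
          ‖MvPolynomial.eval (fun j => l j) (MvPolynomial.X j * q) * φ l‖ := by
        rw [mul_add, mul_one, Finset.mul_sum]
        congr 1
        refine Finset.sum_congr rfl fun j _ => ?_
        rw [map_mul, MvPolynomial.eval_X, mul_assoc (l j), norm_mul (l j), ← hQ]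
        ring
      _ ≤ C * Real.exp (M * ‖rePart d l‖) + ∑ j, C' j * Real.exp (M * ‖rePart d l‖) :=
        add_le_add (h t ht l hl) (Finset.sum_le_sum fun j _ => h' j t ht l hl)
      _ = _ := by rw [add_mul, Finset.sum_mul]

/-- 𝒬_M(R) is stable under multiplication by polynomials. -/
theorem QM_stable_under_polynomial_multiplication
    (d : ℕ) (hd : 1 ≤ d) (Sp : Finset (Ed d)) (hSp : (0 : Ed d) ∉ Sp)
    (R M : ℝ) (hM : 0 < M)
    (φ : Cd d → ℂ) (hφ : memQM d Sp R M φ)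
    (p : MvPolynomial (Fin d) ℂ) :
    memQM d Sp R M (fun l => MvPolynomial.eval (fun j => l j) p * φ l) := by
  refine ⟨memQ_mul d Sp R φ hφ.1 p, fun η hη => ?_⟩
  obtain ⟨t0, ht0, H⟩ := key d Sp R M φ hφ η hη
  obtain ⟨C, hC, h⟩ := key2 d M t0 φ η H (d + 1) p
  refine ⟨t0, C + 1, ht0, by positivity, fun t ht l hl => ?_⟩
  have h1 := h t ht l hl
  have hl0 : 0 < 1 + ‖l‖ := by linarith [norm_nonneg l]
  rw [show -(d : ℝ) - 1 = -((d + 1 : ℕ) : ℝ) by push_cast; ring, Real.rpow_neg hl0.le,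
    Real.rpow_natCast, mul_right_comm, ← div_eq_mul_inv, le_div_iff₀ (by positivity), mul_comm]
  refine h1.trans ?_
  gcongr
  linarith
end
end

section
/- Let φ ∈ 𝒬(R). Then the function f_{λ₀} is independent of the choice of λ₀: for all λ₀, λ₁ ∈ 𝔞*(P,R) ∩ E and all x ∈ E one has f_{λ₀}(x) = f_{λ₁}(x). -/
noncomputable section

open Complex Real

/-- The point λ₀ + iξ of ℂ^d, for λ₀, ξ ∈ ℝ^d. -/
def shift (d : ℕ) (lam0 ξ : Ed d) : Cd d := WithLp.toLp 2 (fun j => (lam0 j : ℂ) + Complex.I * (ξ j : ℂ))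

/-- The function f_{λ₀}(x) = ∫_E e^{⟨λ₀+iξ,x⟩} φ(λ₀+iξ) dξ. -/
def fLam (d : ℕ) (φ : Cd d → ℂ) (lam0 : Ed d) (x : Ed d) : ℂ :=
  ∫ ξ : Ed d, Complex.exp (∑ j, shift d lam0 ξ j * (x j : ℂ)) * φ (shift d lam0 ξ)

open MeasureTheory Filter Topology in
/-- Abstract local lemma. -/
lemma aux_deriv_zero {E : Type*} [NormedAddCommGroup E] [MeasurableSpace E]
    [BorelSpace E] [SecondCountableTopology E] (μ : Measure E)
    (h : ℂ → E → ℂ) (t : ℂ) (δ : ℝ) (hδ : 0 < δ) (b : E → ℝ) (hb : Integrable b μ)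
    (hcont : ∀ z ∈ Metric.ball t (2 * δ), Continuous (h z))
    (hdiff : ∀ ξ, DifferentiableOn ℂ (fun z => h z ξ) (Metric.ball t (2 * δ)))
    (hbd : ∀ z ∈ Metric.ball t (2 * δ), ∀ ξ, ‖h z ξ‖ ≤ b ξ)
    (hinv : ∀ s : ℝ, ∫ ξ, h (t + s * Complex.I) ξ ∂μ = ∫ ξ, h t ξ ∂μ) :
    HasDerivAt (fun z => ∫ ξ, h z ξ ∂μ) 0 t := by
  have hsub : ∀ z ∈ Metric.ball t (δ / 2), Metric.closedBall z δ ⊆ Metric.ball t (2 * δ) := by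
    intro z hz
    apply Metric.closedBall_subset_ball'
    rw [Metric.mem_ball] at hz
    linarith
  have ht : t ∈ Metric.ball t (2 * δ) := Metric.mem_ball_self (by linarith)
  have hda : ∀ ξ, ∀ z ∈ Metric.ball t (2 * δ), HasDerivAt (fun z => h z ξ) (deriv (fun z => h z ξ) z) z := by
    intro ξ z hz
    exact ((hdiff ξ).differentiableAt (Metric.isOpen_ball.mem_nhds hz)).hasDerivAt
  have key := hasDerivAt_integral_of_dominated_loc_of_deriv_le (μ := μ) (𝕜 := ℂ) (F := h)
    (F' := fun z ξ => deriv (fun z => h z ξ) z) (x₀ := t) (s := Metric.ball t (δ / 2))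
    (bound := fun ξ => b ξ / δ) (Metric.ball_mem_nhds _ (by linarith))
    (by
      filter_upwards [Metric.ball_mem_nhds t (show 0 < 2 * δ by linarith)] with z hz
      exact (hcont z hz).aestronglyMeasurable)
    (Integrable.mono' hb (hcont t ht).aestronglyMeasurable (Eventually.of_forall (hbd t ht)))
    (by
      have hu : Tendsto (fun n : ℕ => (((δ * (1 / ((n : ℝ) + 1)) : ℝ)) : ℂ)) atTop (𝓝[≠] 0) := by
        rw [tendsto_nhdsWithin_iff]
        constructor
        · have := (tendsto_one_div_add_atTop_nhds_zero_nat (𝕜 := ℝ)).const_mul δ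
          rw [mul_zero] at this
          exact_mod_cast (Complex.continuous_ofReal.tendsto 0).comp this
        · refine Eventually.of_forall fun n => ?_
          have : 0 < δ * (1 / ((n : ℝ) + 1)) := by positivity
          exact Complex.ofReal_ne_zero.2 this.ne'
      refine aestronglyMeasurable_of_tendsto_ae atTop
        (f := fun (n : ℕ) ξ => ((((δ * (1 / ((n : ℝ) + 1)) : ℝ)) : ℂ))⁻¹ •
          (h (t + ((δ * (1 / ((n : ℝ) + 1)) : ℝ) : ℂ)) ξ - h t ξ)) ?_ ?_
      · intro n
        have hm : t + ((δ * (1 / ((n : ℝ) + 1)) : ℝ) : ℂ) ∈ Metric.ball t (2 * δ) := ?_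
        · have c1 := hcont _ hm
          have c2 := hcont t ht
          exact Continuous.aestronglyMeasurable (by fun_prop)
        have h0 : 0 < δ * (1 / ((n : ℝ) + 1)) := by positivity
        have h1 : 1 / ((n : ℝ) + 1) ≤ 1 := by
          rw [div_le_one (by positivity)]; linarith [Nat.cast_nonneg (α := ℝ) n]
        rw [Metric.mem_ball, dist_eq_norm, add_sub_cancel_left, Complex.norm_real, Real.norm_eq_abs,
          abs_of_pos h0]
        nlinarith
      · refine Eventually.of_forall fun ξ => ?_
        exact ((hasDerivAt_iff_tendsto_slope_zero.1 (hda ξ t ht)).comp hu))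
    (by
      refine Eventually.of_forall fun ξ z hz => ?_
      refine Complex.norm_deriv_le_of_forall_mem_sphere_norm_le hδ ?_ ?_
      · refine DifferentiableOn.diffContOnCl ?_
        refine (hdiff ξ).mono ?_
        exact (Metric.closure_ball_subset_closedBall).trans (hsub z hz)
      · intro w hw
        exact hbd w (hsub z hz (Metric.sphere_subset_closedBall hw)) ξ)
    (hb.div_const δ)
    (by
      refine Eventually.of_forall fun ξ z hz => hda ξ z ?_
      exact Metric.ball_subset_ball (by linarith) hz)
  have k2 := key.2
  set D := ∫ ξ, deriv (fun z => h z ξ) t ∂μ with hD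
  have hline : HasDerivAt (fun s : ℝ => t + s * Complex.I) Complex.I 0 := by
    simpa using ((Complex.ofRealCLM.hasDerivAt (x := 0)).mul_const Complex.I).const_add t
  have h1 : HasDerivAt (fun s : ℝ => ∫ ξ, h (t + s * Complex.I) ξ ∂μ) (Complex.I • D) 0 := by
    refine HasDerivAt.scomp (𝕜' := ℂ) (h := fun s : ℝ => t + s * Complex.I)
      (g₁ := fun z => ∫ ξ, h z ξ ∂μ) (0:ℝ) ?_ hline
    simpa using k2
  have h2 : HasDerivAt (fun s : ℝ => ∫ ξ, h (t + s * Complex.I) ξ ∂μ) 0 0 := by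
    simp only [hinv]
    exact hasDerivAt_const _ _
  have h3 := h1.unique h2
  have h4 : D = 0 := by simpa using h3
  rwa [h4] at k2

/-- The point λ₀ + z v + iξ. -/
def pt (d : ℕ) (a v : Ed d) (z : ℂ) (ξ : Ed d) : Cd d :=
  WithLp.toLp 2 (fun j => (a j : ℂ) + z * (v j : ℂ) + Complex.I * (ξ j : ℂ))

/-- The integrand. -/
def hh (d : ℕ) (φ : Cd d → ℂ) (x a v : Ed d) (z : ℂ) (ξ : Ed d) : ℂ :=
  Complex.exp (∑ j, pt d a v z ξ j * (x j : ℂ)) * φ (pt d a v z ξ)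

lemma rePart_pt (d : ℕ) (a v : Ed d) (z : ℂ) (ξ : Ed d) :
    rePart d (pt d a v z ξ) = a + z.re • v := by
  ext j
  simp [rePart, pt]

lemma pt_cont (d : ℕ) (a v : Ed d) (z : ℂ) : Continuous (pt d a v z) := by
  unfold pt
  fun_prop

lemma pt_diff (d : ℕ) (a v : Ed d) (ξ : Ed d) : Differentiable ℂ (fun z => pt d a v z ξ) := by
  rw [differentiable_euclidean]
  intro j
  simp only [pt]
  fun_prop

lemma pt_mem (d : ℕ) (Sp : Finset (Ed d)) (R : ℝ) (a v : Ed d) (z : ℂ) (ξ : Ed d) :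
    pt d a v z ξ ∈ aStar d Sp R ↔ ∀ α ∈ Sp, ∑ j, (a j + z.re * v j) * α j < R := by
  simp [aStar, pt]

lemma toC_mem (d : ℕ) (Sp : Finset (Ed d)) (R : ℝ) (a : Ed d) :
    toC d a ∈ aStar d Sp R ↔ ∀ α ∈ Sp, ∑ j, a j * α j < R := by
  simp [aStar, toC]

lemma norm_rePart_le (d : ℕ) (l : Cd d) : ‖rePart d l‖ ≤ ‖l‖ := by
  rw [EuclideanSpace.norm_eq, EuclideanSpace.norm_eq]
  refine Real.sqrt_le_sqrt (Finset.sum_le_sum fun j _ => ?_)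
  have : ‖rePart d l j‖ ≤ ‖l j‖ := by
    simpa [rePart] using Complex.abs_re_le_norm (l j)
  gcongr

lemma norm_xi_le (d : ℕ) (a v : Ed d) (z : ℂ) (hz : |z.im| ≤ 1) (ξ : Ed d) :
    ‖ξ‖ ≤ ‖pt d a v z ξ‖ + ‖v‖ := by
  have h1 : ‖rePart d ((-Complex.I) • pt d a v z ξ)‖ ≤ ‖pt d a v z ξ‖ := by
    refine (norm_rePart_le d _).trans ?_
    rw [norm_smul]; simp
  have h2 : rePart d ((-Complex.I) • pt d a v z ξ) = ξ + z.im • v := by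
    ext j
    simp [rePart, pt]
    ring
  rw [h2] at h1
  have h3 : ‖ξ‖ ≤ ‖ξ + z.im • v‖ + ‖z.im • v‖ := by
    simpa using norm_sub_le (ξ + z.im • v) (z.im • v)
  have h4 : ‖z.im • v‖ ≤ ‖v‖ := by
    rw [norm_smul, Real.norm_eq_abs]
    nlinarith [norm_nonneg v]
  linarith

lemma norm_exp_le (d : ℕ) (x : Ed d) (l : Cd d) :
    ‖Complex.exp (∑ j, l j * (x j : ℂ))‖ ≤ Real.exp (‖rePart d l‖ * ‖x‖) := by
  rw [Complex.norm_exp]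
  refine Real.exp_le_exp.2 ?_
  have : (∑ j, l j * (x j : ℂ)).re = inner ℝ (rePart d l) x := by
    simp [PiLp.inner_apply, rePart, mul_comm]
  rw [this]
  exact real_inner_le_norm _ _

lemma hh_inv (d : ℕ) (φ : Cd d → ℂ) (x a v : Ed d) (z : ℂ) (s : ℝ) :
    ∫ ξ, hh d φ x a v (z + s * Complex.I) ξ = ∫ ξ, hh d φ x a v z ξ := by
  have : ∀ ξ, hh d φ x a v (z + s * Complex.I) ξ = hh d φ x a v z (ξ + s • v) := by
    intro ξ
    have : pt d a v (z + s * Complex.I) ξ = pt d a v z (ξ + s • v) := by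
      ext j
      simp [pt]
      ring
    simp only [hh, this]
  simp only [this]
  exact MeasureTheory.integral_add_right_eq_self (fun ξ => hh d φ x a v z ξ) (s • v)

lemma hh_deriv (d : ℕ) (Sp : Finset (Ed d)) (R : ℝ)
    (φ : Cd d → ℂ) (hφ : memQ d Sp R φ) (x a v : Ed d) (t : ℝ)
    (ht : ∀ α ∈ Sp, ∑ j, (a j + t * v j) * α j < R) :
    HasDerivAt (fun z => ∫ ξ, hh d φ x a v z ξ) 0 (t : ℂ) := by
  have hopen : IsOpen {s : ℝ | ∀ α ∈ Sp, ∑ j, (a j + s * v j) * α j < R} := by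
    have : {s : ℝ | ∀ α ∈ Sp, ∑ j, (a j + s * v j) * α j < R} =
        ⋂ α ∈ Sp, {s : ℝ | ∑ j, (a j + s * v j) * α j < R} := by
      ext; simp
    rw [this]
    exact isOpen_biInter_finset fun α _ => isOpen_lt (by fun_prop) continuous_const
  obtain ⟨ε, hε, hball⟩ := Metric.isOpen_iff.1 hopen t ht
  set δ := min (ε / 2) (1 / 2) with hδdef
  have hδ : 0 < δ := by positivity
  have hδ1 : 2 * δ ≤ ε := by linarith [min_le_left (ε / 2) (1 / 2 : ℝ)]
  have hδ2 : 2 * δ ≤ 1 := by linarith [min_le_right (ε / 2) (1 / 2 : ℝ)]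
  have hre : ∀ z ∈ Metric.ball (t : ℂ) (2 * δ), |z.re - t| < 2 * δ ∧ |z.im| ≤ 1 := by
    intro z hz
    rw [Metric.mem_ball, dist_eq_norm] at hz
    have h1 := Complex.abs_re_le_norm (z - t)
    have h2 := Complex.abs_im_le_norm (z - t)
    simp at h1 h2
    exact ⟨by linarith, by linarith⟩
  have hin : ∀ z ∈ Metric.ball (t : ℂ) (2 * δ), ∀ ξ, pt d a v z ξ ∈ aStar d Sp R := by
    intro z hz ξ
    rw [pt_mem]
    refine hball (a := z.re) ?_
    rw [Metric.mem_ball, Real.dist_eq]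
    linarith [(hre z hz).1]
  set ω : Set (Ed d) := (fun s : ℝ => a + s • v) '' Metric.ball t (2 * δ) with hω
  have hωnorm : ∀ y ∈ ω, ‖y‖ ≤ ‖a‖ + (|t| + 1) * ‖v‖ := by
    rintro _ ⟨s, hs, rfl⟩
    rw [Metric.mem_ball, Real.dist_eq] at hs
    refine (norm_add_le _ _).trans ?_
    rw [norm_smul, Real.norm_eq_abs]
    have : |s| ≤ |t| + 1 := by
      have := abs_sub_abs_le_abs_sub s t
      linarith
    gcongr
  have hωb : Bornology.IsBounded ω := isBounded_iff_forall_norm_le.2 ⟨_, hωnorm⟩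
  have hωs : toC d '' ω ⊆ aStar d Sp R := by
    rintro _ ⟨_, ⟨s, hs, rfl⟩, rfl⟩
    rw [toC_mem]
    simpa using hball (Metric.ball_subset_ball hδ1 hs)
  obtain ⟨C, hC⟩ := hφ.2 (d + 1) ω hωb hωs
  set K := Real.exp ((‖a‖ + (|t| + 1) * ‖v‖) * ‖x‖) with hK
  have hint : MeasureTheory.Integrable (fun ξ : Ed d =>
      (K * (C * (1 + ‖v‖) ^ (d + 1))) * (1 + ‖ξ‖) ^ (-((d + 1 : ℕ) : ℝ))) := by
    refine MeasureTheory.Integrable.const_mul ?_ _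
    refine integrable_one_add_norm ?_
    simp
  refine aux_deriv_zero MeasureTheory.volume (hh d φ x a v) t δ hδ _ hint ?_ ?_ ?_ ?_
  · intro z hz
    unfold hh
    refine Continuous.mul ?_ (hφ.1.continuousOn.comp_continuous (pt_cont d a v z) (hin z hz))
    have := pt_cont d a v z
    fun_prop
  · intro ξ
    unfold hh
    refine DifferentiableOn.mul ?_ (hφ.1.comp (pt_diff d a v ξ).differentiableOn
      fun z hz => hin z hz ξ)
    have := differentiable_euclidean.1 (pt_diff d a v ξ)
    fun_prop
  · intro z hz ξ
    have hm : rePart d (pt d a v z ξ) ∈ ω := by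
      rw [rePart_pt]
      refine ⟨z.re, ?_, rfl⟩
      rw [Metric.mem_ball, Real.dist_eq]
      exact (hre z hz).1
    have h1 := hC _ hm
    have h2 := norm_exp_le d x (pt d a v z ξ)
    have h3 : Real.exp (‖rePart d (pt d a v z ξ)‖ * ‖x‖) ≤ K := by
      refine Real.exp_le_exp.2 ?_
      have := hωnorm _ hm
      gcongr
    have h4 := norm_xi_le d a v z (hre z hz).2 ξ
    have h5 : 1 + ‖ξ‖ ≤ (1 + ‖v‖) * (1 + ‖pt d a v z ξ‖) := by
      nlinarith [norm_nonneg v, norm_nonneg (pt d a v z ξ), mul_nonneg (norm_nonneg v) (norm_nonneg (pt d a v z ξ))]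
    have h6 : ‖φ (pt d a v z ξ)‖ ≤ C * (1 + ‖v‖) ^ (d + 1) * (1 + ‖ξ‖) ^ (-((d + 1 : ℕ) : ℝ)) := by
      rw [Real.rpow_neg (by positivity), Real.rpow_natCast, ← div_eq_mul_inv,
        le_div_iff₀ (by positivity)]
      calc ‖φ (pt d a v z ξ)‖ * (1 + ‖ξ‖) ^ (d + 1)
          ≤ ‖φ (pt d a v z ξ)‖ * ((1 + ‖v‖) * (1 + ‖pt d a v z ξ‖)) ^ (d + 1) := by gcongr
        _ = ((1 + ‖pt d a v z ξ‖) ^ (d + 1) * ‖φ (pt d a v z ξ)‖) * (1 + ‖v‖) ^ (d + 1) := by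
            rw [mul_pow]; ring
        _ ≤ C * (1 + ‖v‖) ^ (d + 1) := by gcongr
    unfold hh
    rw [norm_mul, mul_assoc K]
    exact mul_le_mul (h2.trans h3) h6 (norm_nonneg _) (Real.exp_pos _).le
  · intro s
    exact hh_inv d φ x a v t s

/-- f_{λ₀} is independent of the choice of λ₀. -/
theorem fLam_independent_of_basepoint
    (d : ℕ) (hd : 1 ≤ d) (Sp : Finset (Ed d)) (hSp : (0 : Ed d) ∉ Sp) (R : ℝ)
    (φ : Cd d → ℂ) (hφ : memQ d Sp R φ)
    (lam0 lam1 : Ed d) (hlam0 : toC d lam0 ∈ aStar d Sp R)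
    (hlam1 : toC d lam1 ∈ aStar d Sp R) (x : Ed d) :
    fLam d φ lam0 x = fLam d φ lam1 x := by
  rw [toC_mem] at hlam0 hlam1
  have hF : ∀ t ∈ Set.Icc (0:ℝ) 1, HasDerivAt
      (fun s : ℝ => ∫ ξ, hh d φ x lam0 (lam1 - lam0) (s : ℂ) ξ) 0 t := by
    intro t ht
    refine HasDerivAt.comp_ofReal
      (e := fun z : ℂ => ∫ ξ, hh d φ x lam0 (lam1 - lam0) z ξ) (hh_deriv d Sp R φ hφ x _ _ t ?_)
    intro α hα
    have h0 := hlam0 α hα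
    have h1 := hlam1 α hα
    have : ∑ j, (lam0 j + t * (lam1 - lam0) j) * α j
        = (1 - t) * ∑ j, lam0 j * α j + t * ∑ j, lam1 j * α j := by
      rw [Finset.mul_sum, Finset.mul_sum, ← Finset.sum_add_distrib]
      refine Finset.sum_congr rfl fun j _ => ?_
      simp
      ring
    rw [this]
    rcases ht.1.eq_or_lt with h | h
    · subst h; simpa using h0
    · nlinarith [mul_lt_mul_of_pos_left h1 h, mul_le_mul_of_nonneg_left h0.le (sub_nonneg.2 ht.2)]
  have hc := constant_of_has_deriv_right_zero (a := (0:ℝ)) (b := 1)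
    (fun t ht => (hF t ht).continuousAt.continuousWithinAt)
    (fun t ht => (hF t (Set.Ico_subset_Icc_self ht)).hasDerivWithinAt) 1 (by simp)
  have e0 : ∀ ξ, pt d lam0 (lam1 - lam0) ((0:ℝ):ℂ) ξ = shift d lam0 ξ := by
    intro ξ; ext j; simp [pt, shift]
  have e1 : ∀ ξ, pt d lam0 (lam1 - lam0) ((1:ℝ):ℂ) ξ = shift d lam1 ξ := by
    intro ξ; ext j; simp [pt, shift]
  simp only [hh, e0, e1] at hc
  exact hc.symm
end
end

section
/- Let M > 0, let φ ∈ 𝒬_M(R), let λ₀ ∈ 𝔞*(P,R) ∩ E, and let η ∈ E be strictly antidominant. Then f_{λ₀}(x) = 0 for every x ∈ E with ⟨η,x⟩ + M|η| < 0. -/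
noncomputable section

open Complex Real

open MeasureTheory Filter Topology

def gfun (d : ℕ) (φ : Cd d → ℂ) (x : Ed d) (l : Cd d) : ℂ :=
  Complex.exp (∑ j, l j * (x j : ℂ)) * φ l

lemma rePart_shift (d : ℕ) (a ξ : Ed d) : rePart d (shift d a ξ) = a := by
  ext j; simp [rePart, shift]

lemma norm_le_shift (d : ℕ) (a ξ : Ed d) : ‖ξ‖ ≤ ‖shift d a ξ‖ := by
  rw [EuclideanSpace.norm_eq, EuclideanSpace.norm_eq]
  apply Real.sqrt_le_sqrt
  apply Finset.sum_le_sum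
  intro j _
  have h := Complex.abs_im_le_norm (shift d a ξ j)
  have h2 : (shift d a ξ j).im = ξ j := by simp [shift]
  rw [h2] at h
  rw [Real.norm_eq_abs]
  gcongr

lemma shift_mem (d : ℕ) (Sp : Finset (Ed d)) (R : ℝ) (a ξ : Ed d) (h : toC d a ∈ aStar d Sp R) :
    shift d a ξ ∈ aStar d Sp R := by
  intro α hα
  have := h α hα
  simpa [shift, toC] using this

lemma continuous_shift (d : ℕ) : Continuous (fun p : Ed d × Ed d => shift d p.1 p.2) := by
  unfold shift
  fun_prop

lemma isOpen_aStar (d : ℕ) (Sp : Finset (Ed d)) (R : ℝ) : IsOpen (aStar d Sp R) := by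
  have : aStar d Sp R = ⋂ α ∈ Sp, {l : Cd d | (∑ j, (l j).re * α j) < R} := by
    ext l; simp [aStar]
  rw [this]
  apply isOpen_biInter_finset
  intro α _
  apply isOpen_lt _ continuous_const
  fun_prop

lemma gfun_diff (d : ℕ) (Sp : Finset (Ed d)) (R : ℝ) (φ : Cd d → ℂ) (x : Ed d)
    (h : DifferentiableOn ℂ φ (aStar d Sp R)) :
    DifferentiableOn ℂ (gfun d φ x) (aStar d Sp R) := by
  unfold gfun
  apply DifferentiableOn.mul _ h
  apply Differentiable.differentiableOn
  fun_prop

lemma norm_gfun (d : ℕ) (φ : Cd d → ℂ) (x a ξ : Ed d) :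
    ‖gfun d φ x (shift d a ξ)‖ = Real.exp (∑ j, a j * x j) * ‖φ (shift d a ξ)‖ := by
  rw [gfun, norm_mul, Complex.norm_exp]
  simp [shift]

lemma seg_mem (d : ℕ) (Sp : Finset (Ed d)) (R : ℝ) (a u : Ed d) (h0 : toC d a ∈ aStar d Sp R)
    (h1 : toC d (a + u) ∈ aStar d Sp R) (t : ℝ) (ht : t ∈ Set.Icc (0:ℝ) 1) :
    toC d (a + t • u) ∈ aStar d Sp R := by
  intro α hα
  have e0 := h0 α hα
  have e1 := h1 α hα
  simp only [toC, PiLp.add_apply, PiLp.smul_apply, smul_eq_mul, Complex.ofReal_re, add_mul,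
    Finset.sum_add_distrib, mul_assoc, ← Finset.mul_sum] at e0 e1 ⊢
  obtain ⟨t0, t1⟩ := ht
  rcases eq_or_lt_of_le t1 with rfl | t1
  · linarith
  · nlinarith

lemma g_bound (d : ℕ) (Sp : Finset (Ed d)) (R : ℝ) (φ : Cd d → ℂ) (hφ : memQ d Sp R φ)
    (x a u : Ed d) (h0 : toC d a ∈ aStar d Sp R) (h1 : toC d (a + u) ∈ aStar d Sp R) :
    ∃ C : ℝ, ∀ t ∈ Set.Icc (0:ℝ) 1, ∀ ξ : Ed d,
      ‖gfun d φ x (shift d (a + t • u) ξ)‖ ≤ C * (1 + ‖ξ‖) ^ (-((d:ℝ) + 1)) := by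
  have hc : IsCompact ((fun t : ℝ => a + t • u) '' Set.Icc (0:ℝ) 1) :=
    isCompact_Icc.image (by fun_prop)
  obtain ⟨C, hC⟩ := hφ.2 (d+1) _ hc.isBounded (by
    rintro _ ⟨_, ⟨t, ht, rfl⟩, rfl⟩
    exact seg_mem d Sp R a u h0 h1 t ht)
  have hb : ∃ B, ∀ t ∈ Set.Icc (0:ℝ) 1, ‖Real.exp (∑ j, (a + t • u) j * x j)‖ ≤ B :=
    isCompact_Icc.exists_bound_of_continuousOn (Continuous.continuousOn (by
      simp only [PiLp.add_apply, PiLp.smul_apply, smul_eq_mul]; fun_prop))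
  obtain ⟨B, hB⟩ := hb
  refine ⟨B * C, fun t ht ξ => ?_⟩
  rw [norm_gfun]
  have e1 := hB t ht
  rw [Real.norm_eq_abs, abs_of_pos (Real.exp_pos _)] at e1
  have e2 := hC (shift d (a + t • u) ξ) (by rw [rePart_shift]; exact ⟨t, ht, rfl⟩)
  have hp : (0:ℝ) < (1 + ‖ξ‖) ^ (d+1) := by positivity
  have e3 : (1 + ‖ξ‖) ^ (d+1) * ‖φ (shift d (a + t • u) ξ)‖ ≤ C := by
    refine le_trans ?_ e2
    have := norm_le_shift d (a + t • u) ξ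
    gcongr
  have e4 : (1 + ‖ξ‖) ^ (-((d:ℝ) + 1)) = ((1 + ‖ξ‖) ^ (d+1))⁻¹ := by
    rw [Real.rpow_neg (by positivity), ← Real.rpow_natCast]; push_cast; rfl
  rw [e4, mul_assoc]
  have e5 : ‖φ (shift d (a + t • u) ξ)‖ ≤ C * ((1 + ‖ξ‖) ^ (d+1))⁻¹ := by
    rw [← div_eq_mul_inv, le_div_iff₀ hp]; linarith
  exact mul_le_mul e1 e5 (norm_nonneg _) ((Real.exp_pos _).le.trans e1)

lemma int_base (d : ℕ) : Integrable (fun ξ : Ed d => (1 + ‖ξ‖) ^ (-((d:ℝ) + 1))) := by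
  apply integrable_one_add_norm
  simp

lemma g_cont (d : ℕ) (Sp : Finset (Ed d)) (R : ℝ) (φ : Cd d → ℂ) (hφ : memQ d Sp R φ)
    (x a : Ed d) (h0 : toC d a ∈ aStar d Sp R) :
    Continuous (fun ξ => gfun d φ x (shift d a ξ)) := by
  rw [← continuousOn_univ]
  refine (gfun_diff d Sp R φ x hφ.1).continuousOn.comp (t := aStar d Sp R) ?_ ?_
  · exact ((continuous_shift d).comp (by fun_prop : Continuous fun ξ : Ed d => (a, ξ))).continuousOn
  · intro ξ _; exact shift_mem d Sp R a ξ h0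

lemma g_int (d : ℕ) (Sp : Finset (Ed d)) (R : ℝ) (φ : Cd d → ℂ) (hφ : memQ d Sp R φ)
    (x a : Ed d) (h0 : toC d a ∈ aStar d Sp R) :
    Integrable (fun ξ => gfun d φ x (shift d a ξ)) := by
  obtain ⟨C, hC⟩ := g_bound d Sp R φ hφ x a 0 h0 (by simpa using h0)
  refine ((int_base d).const_mul C).mono' (g_cont d Sp R φ hφ x a h0).aestronglyMeasurable ?_
  refine Eventually.of_forall fun ξ => ?_
  simpa using hC 0 (by simp) ξ

/-- averaging -/
lemma avg (d : ℕ) (G : Ed d → ℂ) (hc : Continuous G) (hi : Integrable G) (u : Ed d) :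
    Integrable (fun ξ => ∫ s in (0:ℝ)..1, G (ξ + s • u)) ∧
    ∫ ξ, ∫ s in (0:ℝ)..1, G (ξ + s • u) = ∫ ξ, G ξ := by
  have hp : Integrable (fun p : Ed d × ℝ => G (p.1 + p.2 • u))
      (volume.prod (volume.restrict (Set.Ioc (0:ℝ) 1))) := by
    rw [integrable_prod_iff' (Continuous.aestronglyMeasurable (by fun_prop))]
    refine ⟨Eventually.of_forall fun s => hi.comp_add_right (s • u), ?_⟩
    have : ∀ s : ℝ, ∫ ξ, ‖G (ξ + s • u)‖ = ∫ ξ, ‖G ξ‖ := fun s =>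
      integral_add_right_eq_self (fun ξ => ‖G ξ‖) (s • u)
    simp only [this]
    exact integrable_const _
  simp only [intervalIntegral.integral_of_le zero_le_one]
  refine ⟨hp.integral_prod_left, ?_⟩
  rw [integral_integral_swap hp]
  have : ∀ s : ℝ, ∫ ξ, G (ξ + s • u) = ∫ ξ, G ξ := fun s =>
      integral_add_right_eq_self G (s • u)
  simp [this]

lemma H_int (d : ℕ) (Sp : Finset (Ed d)) (R : ℝ) (φ : Cd d → ℂ) (hφ : memQ d Sp R φ)
    (x a u : Ed d) (h0 : toC d a ∈ aStar d Sp R) (h1 : toC d (a + u) ∈ aStar d Sp R) :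
    Integrable (fun ξ => ∫ t in (0:ℝ)..1, gfun d φ x (shift d (a + t • u) ξ)) := by
  obtain ⟨C, hC⟩ := g_bound d Sp R φ hφ x a u h0 h1
  simp only [intervalIntegral.integral_of_le zero_le_one]
  have hp : Integrable (fun p : Ed d × ℝ => gfun d φ x (shift d (a + p.2 • u) p.1))
      (volume.prod (volume.restrict (Set.Ioc (0:ℝ) 1))) := by
    have hr : (volume : Measure (Ed d)).prod (volume.restrict (Set.Ioc (0:ℝ) 1))
        = (volume.prod volume).restrict (Set.univ ×ˢ Set.Ioc (0:ℝ) 1) := by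
      rw [← Measure.prod_restrict, Measure.restrict_univ]
    have hb : Integrable (fun p : Ed d × ℝ => (C * (1 + ‖p.1‖) ^ (-((d:ℝ) + 1))) * (1:ℝ))
        (volume.prod (volume.restrict (Set.Ioc (0:ℝ) 1))) :=
      ((int_base d).const_mul C).mul_prod (integrable_const (1:ℝ))
    refine hb.mono' ?_ ?_
    · rw [hr]
      refine ContinuousOn.aestronglyMeasurable ?_ (MeasurableSet.univ.prod measurableSet_Ioc)
      refine (gfun_diff d Sp R φ x hφ.1).continuousOn.comp (t := aStar d Sp R) ?_ ?_
      · exact ((continuous_shift d).comp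
          (by fun_prop : Continuous fun p : Ed d × ℝ => (a + p.2 • u, p.1))).continuousOn
      · rintro ⟨ξ, t⟩ ⟨_, ht⟩
        exact shift_mem d Sp R _ ξ (seg_mem d Sp R a u h0 h1 t ⟨ht.1.le, ht.2⟩)
    · rw [hr]
      refine (ae_restrict_iff' (MeasurableSet.univ.prod measurableSet_Ioc)).2
        (Eventually.of_forall ?_)
      rintro ⟨ξ, t⟩ ⟨_, ht⟩
      simpa using hC t ⟨ht.1.le, ht.2⟩ ξ
  exact hp.integral_prod_left

lemma rect (d : ℕ) (Sp : Finset (Ed d)) (R : ℝ) (φ : Cd d → ℂ) (hφ : memQ d Sp R φ)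
    (x a u : Ed d) (h0 : toC d a ∈ aStar d Sp R) (h1 : toC d (a + u) ∈ aStar d Sp R) (ξ : Ed d) :
    (∫ t in (0:ℝ)..1, gfun d φ x (shift d (a + t • u) ξ))
      - (∫ t in (0:ℝ)..1, gfun d φ x (shift d (a + t • u) (ξ + u)))
      + I * (∫ s in (0:ℝ)..1, gfun d φ x (shift d (a + u) (ξ + s • u)))
      - I * (∫ s in (0:ℝ)..1, gfun d φ x (shift d a (ξ + s • u))) = 0 := by
  have key : ∀ t s : ℝ, shift d a ξ + ((t:ℂ) + s * I) • toC d u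
      = shift d (a + t • u) (ξ + s • u) := by
    intro t s
    ext j
    simp [shift, toC]
    ring
  have := Complex.integral_boundary_rect_eq_zero_of_differentiableOn
    (fun z : ℂ => gfun d φ x (shift d a ξ + z • toC d u)) 0 (1 + I) (by
      refine (gfun_diff d Sp R φ x hφ.1).comp (t := aStar d Sp R) ?_ ?_
      · apply Differentiable.differentiableOn; fun_prop
      · intro z hz
        have hz' := hz.1
        simp at hz'
        have := key z.re z.im
        rw [Complex.re_add_im] at this
        change shift d a ξ + z • toC d u ∈ _
        rw [this]
        exact shift_mem d Sp R _ _ (seg_mem d Sp R a u h0 h1 _ hz'))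
  have k0 : ∀ t : ℝ, shift d a ξ + t • toC d u = shift d (a + t • u) ξ := by
    intro t; simpa using key t 0
  have k1 : ∀ t : ℝ, shift d a ξ + ((t:ℂ) + I) • toC d u = shift d (a + t • u) (ξ + u) := by
    intro t; simpa using key t 1
  have k2 : ∀ s : ℝ, shift d a ξ + ((s:ℂ) * I) • toC d u = shift d a (ξ + s • u) := by
    intro s; simpa using key 0 s
  have k3 : ∀ s : ℝ, shift d a ξ + (1 + (s:ℂ) * I) • toC d u = shift d (a + u) (ξ + s • u) := by
    intro s; simpa using key 1 s
  simpa [k0, k1, k2, k3] using this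

lemma fLam_shift (d : ℕ) (Sp : Finset (Ed d)) (R : ℝ) (φ : Cd d → ℂ) (hφ : memQ d Sp R φ)
    (x a u : Ed d) (h0 : toC d a ∈ aStar d Sp R) (h1 : toC d (a + u) ∈ aStar d Sp R) :
    fLam d φ a x = fLam d φ (a + u) x := by
  obtain ⟨i0, e0⟩ := avg d _ (g_cont d Sp R φ hφ x a h0) (g_int d Sp R φ hφ x a h0) u
  obtain ⟨i1, e1⟩ := avg d _ (g_cont d Sp R φ hφ x _ h1) (g_int d Sp R φ hφ x _ h1) u
  have hH := H_int d Sp R φ hφ x a u h0 h1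
  have hz : ∫ ξ, ((∫ s in (0:ℝ)..1, gfun d φ x (shift d (a + u) (ξ + s • u)))
      - (∫ s in (0:ℝ)..1, gfun d φ x (shift d a (ξ + s • u)))) =
      ∫ ξ, -I * ((∫ t in (0:ℝ)..1, gfun d φ x (shift d (a + t • u) (ξ + u)))
        - (∫ t in (0:ℝ)..1, gfun d φ x (shift d (a + t • u) ξ))) := by
    congr 1; ext ξ
    linear_combination (-I) * rect d Sp R φ hφ x a u h0 h1 ξ +
      ((∫ s in (0:ℝ)..1, gfun d φ x (shift d (a + u) (ξ + s • u)))
      - (∫ s in (0:ℝ)..1, gfun d φ x (shift d a (ξ + s • u)))) * (I_sq)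
  rw [integral_sub i1 i0, e1, e0, integral_const_mul, integral_sub (hH.comp_add_right u) hH,
    integral_add_right_eq_self (fun ξ => ∫ t in (0:ℝ)..1, gfun d φ x (shift d (a + t • u) ξ)) u,
    sub_self, mul_zero, sub_eq_zero] at hz
  exact hz.symm

/-- For φ ∈ 𝒬_M(R), f_{λ₀} vanishes on the set
where ⟨η,x⟩ + M|η| < 0 for a strictly antidominant η. -/
theorem fLam_vanishes
    (d : ℕ) (hd : 1 ≤ d) (Sp : Finset (Ed d)) (hSp : (0 : Ed d) ∉ Sp)
    (R M : ℝ) (hM : 0 < M)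
    (φ : Cd d → ℂ) (hφ : memQM d Sp R M φ)
    (lam0 : Ed d) (hlam0 : toC d lam0 ∈ aStar d Sp R)
    (η : Ed d) (hη : Antidom d Sp η)
    (x : Ed d) (hx : (∑ j, η j * x j) + M * ‖η‖ < 0) :
    fLam d φ lam0 x = 0 := by
  obtain ⟨tη, C, ht, hC, hb⟩ := hφ.2 η hη
  set δ := (∑ j, η j * x j) + M * ‖η‖ with hδ
  set K := ∫ ξ : Ed d, C * (1 + ‖ξ‖) ^ (-((d:ℝ) + 1)) with hK
  have hev : ∀ᶠ t : ℝ in atTop, toC d (t • η) ∈ aStar d Sp R := by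
    have : ∀ᶠ t : ℝ in atTop, ∀ α ∈ Sp, t * (∑ j, η j * α j) < R := by
      rw [Filter.eventually_all_finset]
      intro α hα
      exact (tendsto_id.atTop_mul_const_of_neg (hη α hα)).eventually_lt_atBot R
    filter_upwards [this] with t h α hα
    simpa [toC, mul_assoc, ← Finset.mul_sum] using h α hα
  have hle : ∀ᶠ t : ℝ in atTop, ‖fLam d φ lam0 x‖ ≤ Real.exp (t * δ) * K := by
    filter_upwards [hev, eventually_ge_atTop tη] with t h1 h2
    have h3 : toC d (lam0 + (t • η - lam0)) ∈ aStar d Sp R := by simpa using h1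
    rw [fLam_shift d Sp R φ hφ.1 x lam0 _ hlam0 h3, add_sub_cancel, hK, ← integral_const_mul]
    refine norm_integral_le_of_norm_le (((int_base d).const_mul C).const_mul _)
      (Eventually.of_forall fun ξ => ?_)
    have e := norm_gfun d φ x (t • η) ξ
    rw [gfun] at e
    rw [e]
    have e2 := hb t h2 (shift d (t • η) ξ) (rePart_shift _ _ _)
    rw [rePart_shift, norm_smul, Real.norm_eq_abs, abs_of_pos (ht.trans_le h2)] at e2
    have e3 : (1 + ‖shift d (t • η) ξ‖) ^ (-(d:ℝ) - 1) ≤ (1 + ‖ξ‖) ^ (-((d:ℝ) + 1)) := by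
      rw [show -(d:ℝ) - 1 = -((d:ℝ) + 1) by ring]
      apply Real.rpow_le_rpow_of_nonpos (by positivity)
      · linarith [norm_le_shift d (t • η) ξ]
      · have : (0:ℝ) ≤ d := Nat.cast_nonneg d
        linarith
    have e4 : ∑ j, (t • η) j * x j = t * ∑ j, η j * x j := by
      simp [mul_assoc, Finset.mul_sum]
    rw [e4]
    calc _ ≤ Real.exp (t * ∑ j, η j * x j) *
          (C * (1 + ‖ξ‖) ^ (-((d:ℝ) + 1)) * Real.exp (M * (t * ‖η‖))) := by
          gcongr
          exact e2.trans (by gcongr)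
      _ = _ := by
          rw [show t * δ = t * (∑ j, η j * x j) + M * (t * ‖η‖) by rw [hδ]; ring, Real.exp_add]
          ring
  have hlim : Tendsto (fun t : ℝ => Real.exp (t * δ) * K) atTop (𝓝 0) := by
    have := (Real.tendsto_exp_atBot.comp (tendsto_id.atTop_mul_const_of_neg hx)).mul_const K
    simpa using this
  exact norm_le_zero_iff.1 (ge_of_tendsto hlim hle)
end
end
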